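/- The event {ω ∈ Ω : for some t ∈ (0,∞), [t,∞) is a ray of local maximum or a ray of local minimum for ω} is completely uncertain, i.e. both this event and its complement have upper probability 1. -/

import Mathlib

open Filter Topology MeasureTheory
open scoped ENNReal NNReal

namespace GTP

/-- The sample space `Ω`: all continuous functions `ω : [0,∞) → ℝ`. -/
def Omega : Type := {f : ℝ≥0 → ℝ // Continuous f}

/-- The filtration: `F t` is the smallest σ-algebra on `Ω` making all maps
`ω ↦ ω s`, `s ∈ [0,t]`, measurable. -/
def F (t : ℝ≥0) : MeasurableSpace Omega :=
  ⨆ s : {s : ℝ≥0 // s ≤ t},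
    MeasurableSpace.comap (fun ω : Omega => ω.1 s.1) inferInstance

/-- A stopping time relative to the filtration `(F t)`, with values in `[0,∞]`. -/
def IsStopping (τ : Omega → ℝ≥0∞) : Prop :=
  ∀ t : ℝ≥0, MeasurableSet[F t] {ω : Omega | τ ω ≤ (t : ℝ≥0∞)}

/-- `F_τ`-measurability of a function `h : Ω → ℝ`. -/
def MeasurableAtTime (τ : Omega → ℝ≥0∞) (h : Omega → ℝ) : Prop :=
  ∀ B : Set ℝ, MeasurableSet B → ∀ t : ℝ≥0,
    MeasurableSet[F t] (h ⁻¹' B ∩ {ω : Omega | τ ω ≤ (t : ℝ≥0∞)})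

/-- An elementary trading strategy: an increasing sequence of stopping times
`τ₁ ≤ τ₂ ≤ ⋯` tending to `∞`, together with bounded `F_{τ_n}`-measurable
portfolio functions `h_n`. -/
structure ElemStrategy where
  τ : ℕ → Omega → ℝ≥0∞
  stopping : ∀ n, IsStopping (τ n)
  mono : ∀ n ω, τ n ω ≤ τ (n + 1) ω
  tendsto_top : ∀ ω, Tendsto (fun n => τ n ω) atTop (𝓝 ⊤)
  h : ℕ → Omega → ℝ
  h_bdd : ∀ n, ∃ C : ℝ, ∀ ω, |h n ω| ≤ C
  h_meas : ∀ n, MeasurableAtTime (τ n) (h n)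

/-- The time `τ ∧ t` as an element of `[0,∞)`. -/
noncomputable def clip (τ : Omega → ℝ≥0∞) (t : ℝ≥0) (ω : Omega) : ℝ≥0 :=
  (min (τ ω) (t : ℝ≥0∞)).toNNReal

/-- The elementary capital process
`K_t(ω) := c + Σ_n h_n(ω) (ω(τ_{n+1} ∧ t) − ω(τ_n ∧ t))`. -/
noncomputable def elemCapital (G : ElemStrategy) (c : ℝ) (t : ℝ≥0) (ω : Omega) : ℝ :=
  c + ∑' n : ℕ, G.h n ω * (ω.1 (clip (G.τ (n + 1)) t ω) - ω.1 (clip (G.τ n) t ω))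

/-- A positive capital process: a countable sum of nonnegative elementary capital
processes with strictly positive summable initial capitals. -/
structure PosCapital where
  G : ℕ → ElemStrategy
  c : ℕ → ℝ
  c_pos : ∀ n, 0 < c n
  c_summable : Summable c
  nonneg : ∀ n t ω, 0 ≤ elemCapital (G n) (c n) t ω

/-- The value `S_t(ω) ∈ [0,∞]` of a positive capital process. -/
noncomputable def PosCapital.value (S : PosCapital) (t : ℝ≥0) (ω : Omega) : ℝ≥0∞ :=
  ∑' n : ℕ, ENNReal.ofReal (elemCapital (S.G n) (S.c n) t ω)

/-- The initial value `S_0` of a positive capital process (independent of `ω`,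
since `K^{G_n,c_n}_0 = c_n`). -/
noncomputable def PosCapital.init (S : PosCapital) : ℝ≥0∞ :=
  ∑' n : ℕ, ENNReal.ofReal (S.c n)

/-- Upper probability:
`UpProb(E) := inf { S₀ : S a positive capital process, liminf_{t→∞} S_t ≥ 1_E }`. -/
noncomputable def UpProb (E : Set Omega) : ℝ≥0∞ :=
  ⨅ (S : PosCapital) (_ : ∀ ω : Omega,
      E.indicator (fun _ => (1 : ℝ≥0∞)) ω ≤ liminf (fun t : ℝ≥0 => S.value t ω) atTop),
    S.init

/-- A set is null if its upper probability is `0`. -/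
def IsNull (E : Set Omega) : Prop := UpProb E = 0

/-- `[t₁,t₂]` is an interval of local extremum for `ω`, where the comparison
relation `r` is `≤` for a local maximum, `≥` for a local minimum, `<` for a
strict local maximum and `>` for a strict local minimum: (a) `ω` is constant on
`[t₁,t₂]` but on no larger interval, and (b) for some `δ > 0`,
`r (ω s) (ω t)` for all `s ∈ ((t₁−δ)⁺,t₁) ∪ (t₂,t₂+δ)` and `t ∈ [t₁,t₂]`. -/
def IntervalOfLocalExt (r : ℝ → ℝ → Prop) (ω : Omega) (t₁ t₂ : ℝ≥0) : Prop :=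
  t₁ ≤ t₂ ∧
  (∀ t ∈ Set.Icc t₁ t₂, ω.1 t = ω.1 t₁) ∧
  (¬ ∃ s₁ s₂ : ℝ≥0, s₁ ≤ t₁ ∧ t₂ ≤ s₂ ∧ (s₁ < t₁ ∨ t₂ < s₂) ∧
      ∀ t ∈ Set.Icc s₁ s₂, ω.1 t = ω.1 t₁) ∧
  ∃ δ : ℝ, 0 < δ ∧ ∀ s : ℝ≥0,
    (((t₁ : ℝ) - δ < (s : ℝ) ∧ s < t₁) ∨ (t₂ < s ∧ (s : ℝ) < (t₂ : ℝ) + δ)) →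
      r (ω.1 s) (ω.1 t₁)

/-- `[t,∞)` is a ray of local extremum for `ω` (with `r` as above): (a) `ω` is
constant on `[t,∞)` but on no larger ray `[s,∞)`, `s ∈ (0,t)`, and (b) for some
`δ > 0`, `r (ω s) (ω t)` for all `s ∈ ((t−δ)⁺, t)`. -/
def RayOfLocalExt (r : ℝ → ℝ → Prop) (ω : Omega) (t : ℝ≥0) : Prop :=
  (∀ u : ℝ≥0, t ≤ u → ω.1 u = ω.1 t) ∧
  (¬ ∃ s : ℝ≥0, 0 < s ∧ s < t ∧ ∀ u : ℝ≥0, s ≤ u → ω.1 u = ω.1 t) ∧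
  ∃ δ : ℝ, 0 < δ ∧ ∀ s : ℝ≥0, (t : ℝ) - δ < (s : ℝ) → s < t → r (ω.1 s) (ω.1 t)

/-! ### Part 1 : the Lévy–Ciesielski construction of a Brownian motion on `[0,1]` -/

/-- The hat function supported on `[0,1]`. -/
noncomputable def hat (x : ℝ) : ℝ := max 0 (1 - |2 * x - 1|)

lemma hat_nonneg (x : ℝ) : 0 ≤ hat x := le_max_left _ _

lemma hat_le_one (x : ℝ) : hat x ≤ 1 :=
  max_le zero_le_one (by linarith [abs_nonneg (2 * x - 1)])

lemma hat_of_nonpos {x : ℝ} (hx : x ≤ 0) : hat x = 0 := by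
  unfold hat
  apply max_eq_left
  rw [abs_of_nonpos (by linarith)]; linarith

lemma hat_of_one_le {x : ℝ} (hx : 1 ≤ x) : hat x = 0 := by
  unfold hat
  apply max_eq_left
  rw [abs_of_nonneg (by linarith)]; linarith

lemma hat_left {x : ℝ} (h0 : 0 ≤ x) (hx : x ≤ 1 / 2) : hat x = 2 * x := by
  unfold hat
  rw [abs_of_nonpos (by linarith), max_eq_right (by linarith)]; ring

lemma hat_right {x : ℝ} (h0 : 1 / 2 ≤ x) (hx : x ≤ 1) : hat x = 2 * (1 - x) := by
  unfold hat
  rw [abs_of_nonneg (by linarith), max_eq_right (by linarith)]; ring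

lemma continuous_hat : Continuous hat := by unfold hat; fun_prop

lemma hat_int (j : ℤ) : hat j = 0 := by
  rcases le_or_gt j 0 with h | h
  · exact hat_of_nonpos (by exact_mod_cast h)
  · exact hat_of_one_le (by exact_mod_cast h)

lemma sum_hat_le (N : ℕ) (x : ℝ) : ∑ k ∈ Finset.range N, hat (x - k) ≤ 1 := by
  have : ∀ k ∈ Finset.range N, hat (x - k) ≤ if k = ⌊x⌋₊ then 1 else 0 := by
    intro k _
    split_ifs with h
    · exact hat_le_one _
    · rcases lt_or_gt_of_ne h with h | h
      · rw [hat_of_one_le]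
        have h1 : (k + 1 : ℕ) ≤ x := (Nat.le_floor_iff' (by omega)).1 h
        push_cast at h1; linarith
      · rw [hat_of_nonpos]
        have h1 := (Nat.floor_lt' (by omega)).1 h
        linarith
  refine (Finset.sum_le_sum this).trans ?_
  rw [Finset.sum_ite_eq']
  split_ifs <;> norm_num

/-- Level `n` part of the covariance. -/
noncomputable def hT (n : ℕ) (s t : ℝ) : ℝ :=
  ∑ k ∈ Finset.range (2 ^ n), hat (2 ^ n * s - k) * hat (2 ^ n * t - k)

lemma hT_succ (n : ℕ) (s t : ℝ) :
    hT (n + 1) s t = hT n (2 * s) (2 * t) + hT n (2 * s - 1) (2 * t - 1) := by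
  unfold hT
  rw [pow_succ, mul_two, Finset.sum_range_add]
  congr 1
  · refine Finset.sum_congr rfl fun k _ => ?_
    rw [pow_succ, mul_assoc, mul_assoc]
  · refine Finset.sum_congr rfl fun k _ => ?_
    push_cast
    congr 2 <;> ring

lemma hT_zero (s t : ℝ) : hT 0 s t = hat s * hat t := by simp [hT]

lemma hT_eq_zero (n : ℕ) (s t : ℝ) (h : s ≤ 0 ∨ 1 ≤ s ∨ t ≤ 0 ∨ 1 ≤ t) : hT n s t = 0 := by
  unfold hT
  refine Finset.sum_eq_zero fun k hk => ?_
  have hk' : (k : ℝ) + 1 ≤ 2 ^ n := by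
    have := Finset.mem_range.1 hk
    exact_mod_cast this
  have h2 : (0 : ℝ) < 2 ^ n := by positivity
  have hk0 : (0 : ℝ) ≤ k := by positivity
  rcases h with h | h | h | h
  · rw [hat_of_nonpos (by nlinarith), zero_mul]
  · rw [hat_of_one_le (by nlinarith), zero_mul]
  · rw [hat_of_nonpos (x := 2 ^ n * t - k) (by nlinarith), mul_zero]
  · rw [hat_of_one_le (x := 2 ^ n * t - k) (by nlinarith), mul_zero]

/-- Partial covariance of the bridge part. -/
noncomputable def hR (m : ℕ) (s t : ℝ) : ℝ :=
  ∑ n ∈ Finset.range m, (1 / 2) ^ n / 4 * hT n s t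

lemma hR_eq_zero (n : ℕ) (s t : ℝ) (h : s ≤ 0 ∨ 1 ≤ s ∨ t ≤ 0 ∨ 1 ≤ t) : hR n s t = 0 := by
  unfold hR
  exact Finset.sum_eq_zero fun k _ => by rw [hT_eq_zero _ _ _ h, mul_zero]

lemma hR_succ (m : ℕ) (s t : ℝ) :
    hR (m + 1) s t = hat s * hat t / 4
      + (hR m (2 * s) (2 * t) + hR m (2 * s - 1) (2 * t - 1)) / 2 := by
  unfold hR
  rw [Finset.sum_range_succ', ← Finset.sum_add_distrib, Finset.sum_div, add_comm]
  congr 1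
  · rw [hT_zero]; ring
  · refine Finset.sum_congr rfl fun n _ => ?_
    rw [hT_succ]; ring

lemma hR_eq (m : ℕ) : ∀ s t : ℝ, 0 ≤ s → s ≤ 1 → 0 ≤ t → t ≤ 1 →
    (∃ j : ℤ, 2 ^ m * s = j) → hR m s t = min s t - s * t := by
  induction m with
  | zero =>
    rintro s t hs hs1 ht ht1 ⟨j, hj⟩
    have hj : s = j := by simpa using hj
    have : j = 0 ∨ j = 1 := by
      have h1 : (0 : ℤ) ≤ j := by exact_mod_cast hj ▸ hs
      have h2 : j ≤ 1 := by exact_mod_cast hj ▸ hs1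
      omega
    rcases this with h | h
    · subst h
      have hs : s = 0 := by simpa using hj
      subst hs
      simp [hR, ht]
    · subst h
      have hs : s = 1 := by simpa using hj
      subst hs
      simp [hR, ht1]
  | succ m ih =>
    rintro s t hs hs1 ht ht1 ⟨j, hj⟩
    rw [hR_succ]
    rcases le_total s (1 / 2) with hs2 | hs2 <;> rcases le_total t (1 / 2) with ht2 | ht2
    · rw [ih (2 * s) (2 * t) (by linarith) (by linarith) (by linarith) (by linarith)
        ⟨j, by rw [← hj]; ring⟩, hR_eq_zero m (2 * s - 1) _ (Or.inl (by linarith)),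
        hat_left hs hs2, hat_left ht ht2]
      rcases le_total s t with h | h
      · rw [min_eq_left h, min_eq_left (by linarith)]; ring
      · rw [min_eq_right h, min_eq_right (by linarith)]; ring
    · rw [hR_eq_zero m (2 * s - 1) _ (Or.inl (by linarith)),
        hR_eq_zero m (2 * s) _ (Or.inr (Or.inr (Or.inr (by linarith)))),
        hat_left hs hs2, hat_right ht2 ht1, min_eq_left (by linarith)]
      ring
    · rw [hR_eq_zero m (2 * s - 1) _ (Or.inr (Or.inr (Or.inl (by linarith)))),
        hR_eq_zero m (2 * s) _ (Or.inr (Or.inl (by linarith))),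
        hat_right hs2 hs1, hat_left ht ht2, min_eq_right (by linarith)]
      ring
    · rw [ih (2 * s - 1) (2 * t - 1) (by linarith) (by linarith) (by linarith) (by linarith)
        ⟨j - 2 ^ m, by push_cast; rw [← hj]; ring⟩,
        hR_eq_zero m (2 * s) _ (Or.inr (Or.inl (by linarith))),
        hat_right hs2 hs1, hat_right ht2 ht1]
      rcases le_total s t with h | h
      · rw [min_eq_left h, min_eq_left (by linarith)]; ring
      · rw [min_eq_right h, min_eq_right (by linarith)]; ring

/-- The sample space carrying the Gaussian coordinates. -/
abbrev GW : Type := ℕ × ℕ → ℝ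

/-- The law of i.i.d. standard Gaussian coordinates. -/
noncomputable def gP : Measure GW :=
  Measure.infinitePi (fun _ : ℕ × ℕ => ProbabilityTheory.gaussianReal 0 1)

instance gP_prob : IsProbabilityMeasure gP := by unfold gP; infer_instance

noncomputable def cc (n : ℕ) : ℝ := (√(1 / 2)) ^ n / 2

lemma cc_pos (n : ℕ) : 0 < cc n := by unfold cc; positivity

lemma cc_sq (n : ℕ) : cc n ^ 2 = (1 / 2) ^ n / 4 := by
  unfold cc
  rw [div_pow, ← pow_mul, mul_comm, pow_mul, Real.sq_sqrt (by norm_num)]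
  norm_num

noncomputable def aa (n : ℕ) : ℝ := (9 / 10) ^ n

lemma aa_pos (n : ℕ) : 0 < aa n := by unfold aa; positivity

noncomputable def lev (n : ℕ) (w : GW) (u : ℝ≥0) : ℝ :=
  cc n * ∑ k ∈ Finset.range (2 ^ n), hat (2 ^ n * u - k) * w (n + 1, k)

noncomputable def ee (n : ℕ) (w : GW) : ℝ :=
  cc n ^ 4 / aa n ^ 3 * ∑ k ∈ Finset.range (2 ^ n), w (n + 1, k) ^ 4

lemma ee_nonneg (n : ℕ) (w : GW) : 0 ≤ ee n w := by
  unfold ee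
  have := cc_pos n
  have := aa_pos n
  exact mul_nonneg (by positivity) (Finset.sum_nonneg fun k _ => by positivity)

lemma cz_le (n : ℕ) (z : ℝ) : cc n * |z| ≤ aa n + cc n ^ 4 / aa n ^ 3 * z ^ 4 := by
  have hc := cc_pos n
  have ha := aa_pos n
  have key : ∀ x : ℝ, x ≤ 1 + x ^ 4 := fun x => by nlinarith [sq_nonneg (x ^ 2 - 1 / 2), sq_nonneg (x - 1 / 2)]
  have h := mul_le_mul_of_nonneg_left (key (cc n * |z| / aa n)) ha.le
  have e1 : aa n * (cc n * |z| / aa n) = cc n * |z| := by field_simp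
  have e2 : aa n * (1 + (cc n * |z| / aa n) ^ 4) = aa n + cc n ^ 4 / aa n ^ 3 * z ^ 4 := by
    rw [div_pow, mul_pow, (by decide : Even 4).pow_abs]
    field_simp
  rw [e1, e2] at h
  exact h

lemma lev_le (n : ℕ) (w : GW) (u : ℝ≥0) : |lev n w u| ≤ aa n + ee n w := by
  have hc := cc_pos n
  have ha := aa_pos n
  unfold lev
  rw [abs_mul, abs_of_pos hc]
  calc cc n * |∑ k ∈ Finset.range (2 ^ n), hat (2 ^ n * u - k) * w (n + 1, k)|
      ≤ cc n * ∑ k ∈ Finset.range (2 ^ n), |hat (2 ^ n * u - k) * w (n + 1, k)| := by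
        gcongr; exact Finset.abs_sum_le_sum_abs _ _
    _ = ∑ k ∈ Finset.range (2 ^ n), hat (2 ^ n * u - k) * (cc n * |w (n + 1, k)|) := by
        rw [Finset.mul_sum]
        refine Finset.sum_congr rfl fun k _ => ?_
        rw [abs_mul, abs_of_nonneg (hat_nonneg _)]; ring
    _ ≤ ∑ k ∈ Finset.range (2 ^ n), (hat (2 ^ n * u - k) * aa n
          + cc n ^ 4 / aa n ^ 3 * w (n + 1, k) ^ 4) := by
        refine Finset.sum_le_sum fun k _ => ?_
        have h1 := mul_le_mul_of_nonneg_left (cz_le n (w (n + 1, k))) (hat_nonneg (2 ^ n * u - k))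
        have h2 : 0 ≤ cc n ^ 4 / aa n ^ 3 * w (n + 1, k) ^ 4 := by positivity
        have h3 := mul_le_mul_of_nonneg_right (hat_le_one (2 ^ n * u - k)) h2
        linarith
    _ = (∑ k ∈ Finset.range (2 ^ n), hat (2 ^ n * u - k)) * aa n + ee n w := by
        rw [Finset.sum_add_distrib, ← Finset.sum_mul, ee, Finset.mul_sum]
    _ ≤ aa n + ee n w := by
        have := mul_le_mul_of_nonneg_right (sum_hat_le (2 ^ n) (2 ^ n * u)) ha.le
        linarith

lemma summable_aa : Summable aa :=
  summable_geometric_of_lt_one (by norm_num) (by norm_num)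

/-- The random variable controlling the convergence. -/
noncomputable def WW (w : GW) : ℝ≥0∞ := ∑' n, ENNReal.ofReal (ee n w)

lemma measurable_ee (n : ℕ) : Measurable (ee n) := by
  unfold ee
  fun_prop

lemma measurable_WW : Measurable WW :=
  Measurable.tsum fun n => (measurable_ee n).ennreal_ofReal

lemma coord_mp (i : ℕ × ℕ) :
    MeasurePreserving (fun w : GW => w i) gP (ProbabilityTheory.gaussianReal 0 1) :=
  measurePreserving_eval_infinitePi (fun _ : ℕ × ℕ => ProbabilityTheory.gaussianReal 0 1) i

noncomputable def kap : ℝ := ∫ x, x ^ 4 ∂(ProbabilityTheory.gaussianReal 0 1)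

lemma integrable_pow4 : Integrable (fun x : ℝ => x ^ 4) (ProbabilityTheory.gaussianReal 0 1) := by
  have h := (ProbabilityTheory.memLp_id_gaussianReal (μ := 0) (v := 1) 4).integrable_norm_pow
    (by norm_num)
  refine h.congr (ae_of_all _ fun x => ?_)
  simp [(by decide : Even 4).pow_abs]

lemma integrable_coord4 (i : ℕ × ℕ) : Integrable (fun w : GW => w i ^ 4) gP :=
  (coord_mp i).integrable_comp_of_integrable integrable_pow4

lemma integral_coord4 (i : ℕ × ℕ) : ∫ w : GW, w i ^ 4 ∂gP = kap := by
  have := (coord_mp i).map_eq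
  rw [kap, ← this, integral_map (coord_mp i).measurable.aemeasurable
    (by fun_prop)]

lemma integrable_ee (n : ℕ) : Integrable (ee n) gP := by
  unfold ee
  exact (integrable_finsetSum _ fun k _ => integrable_coord4 _).const_mul _

lemma integral_ee (n : ℕ) : ∫ w, ee n w ∂gP = (500 / 729) ^ n * (kap / 16) := by
  unfold ee
  rw [integral_const_mul, integral_finsetSum _ fun k _ => integrable_coord4 _]
  simp_rw [integral_coord4]
  rw [Finset.sum_const, Finset.card_range, nsmul_eq_mul, show cc n ^ 4 = (cc n ^ 2) ^ 2 by ring,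
    cc_sq, aa]
  push_cast
  have e : ((500 : ℝ) / 729) ^ n = ((1 / 2) ^ n) ^ 2 / ((9 / 10) ^ n) ^ 3 * 2 ^ n := by
    rw [← pow_mul, ← pow_mul, mul_comm n 2, mul_comm n 3, pow_mul, pow_mul, ← div_pow, ← mul_pow]
    norm_num
  rw [e, div_pow]
  generalize ((1 / 2 : ℝ) ^ n) = x
  generalize ((9 / 10 : ℝ) ^ n) = y
  generalize ((2 : ℝ) ^ n) = z
  ring

lemma lintegral_WW : ∫⁻ w, WW w ∂gP < ⊤ := by
  unfold WW
  rw [lintegral_tsum fun n => (measurable_ee n).ennreal_ofReal.aemeasurable]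
  have : ∀ n, ∫⁻ w, ENNReal.ofReal (ee n w) ∂gP = ENNReal.ofReal ((500 / 729) ^ n * (kap / 16)) := by
    intro n
    rw [← integral_ee, ofReal_integral_eq_lintegral_ofReal (integrable_ee n)
      (ae_of_all _ (ee_nonneg n))]
  simp_rw [this]
  apply Summable.tsum_ofReal_lt_top
  exact (summable_geometric_of_lt_one (by norm_num) (by norm_num)).mul_right _

lemma ae_good : ∀ᵐ w ∂gP, WW w ≠ ⊤ := by
  filter_upwards [ae_lt_top measurable_WW lintegral_WW.ne] with w hw using hw.ne

lemma summable_ee {w : GW} (hw : WW w ≠ ⊤) : Summable fun n => ee n w := by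
  have := ENNReal.summable_toReal hw
  refine this.congr fun n => ?_
  rw [ENNReal.toReal_ofReal (ee_nonneg n w)]

lemma tsum_ee {w : GW} (_hw : WW w ≠ ⊤) : ∑' n, ee n w = (WW w).toReal := by
  rw [WW, ENNReal.tsum_toReal_eq (fun n => ENNReal.ofReal_ne_top)]
  exact tsum_congr fun n => (ENNReal.toReal_ofReal (ee_nonneg n w)).symm

open Classical in
/-- Brownian motion (on `[0,1]`). -/
noncomputable def bm (w : GW) (u : ℝ≥0) : ℝ :=
  if WW w = ⊤ then 0 else u * w (0, 0) + ∑' n, lev n w u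

lemma summable_lev {w : GW} (hw : WW w ≠ ⊤) (u : ℝ≥0) : Summable fun n => lev n w u :=
  Summable.of_norm_bounded (summable_aa.add (summable_ee hw)) fun n => lev_le n w u

lemma continuous_bm (w : GW) : Continuous (bm w) := by
  unfold bm
  split_ifs with h
  · exact continuous_const
  · refine Continuous.add (by fun_prop) ?_
    refine continuous_tsum (fun n => ?_) (summable_aa.add (summable_ee h)) fun n u => lev_le n w u
    unfold lev
    refine continuous_const.mul (continuous_finsetSum _ fun k _ => ?_)
    exact (continuous_hat.comp (by fun_prop)).mul continuous_const

lemma measurable_lev (n : ℕ) (u : ℝ≥0) : Measurable fun w => lev n w u := by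
  unfold lev; fun_prop

lemma measurable_bm (u : ℝ≥0) : Measurable fun w => bm w u := by
  classical
  have hg : MeasurableSet {w : GW | WW w = ⊤} := measurable_WW (measurableSet_singleton _)
  refine measurable_of_tendsto_metrizable (f := fun N w => if WW w = ⊤ then 0 else
    u * w (0, 0) + ∑ n ∈ Finset.range N, lev n w u) (fun N => ?_) ?_
  · refine Measurable.ite hg measurable_const ?_
    exact Measurable.add (by fun_prop) (Finset.measurable_sum _ fun n _ => measurable_lev n u)
  · rw [tendsto_pi_nhds]
    intro w
    unfold bm
    split_ifs with h
    · exact tendsto_const_nhds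
    · exact (summable_lev h u).hasSum.tendsto_sum_nat.const_add _

lemma lev_int (n : ℕ) (w : GW) (u : ℝ≥0) (j : ℤ) (h : (2 : ℝ) ^ n * u = j) : lev n w u = 0 := by
  unfold lev
  rw [Finset.sum_eq_zero, mul_zero]
  intro k _
  rw [h, show (j : ℝ) - k = ((j - k : ℤ) : ℝ) by push_cast; ring, hat_int, zero_mul]

lemma bm_zero (w : GW) : bm w 0 = 0 := by
  unfold bm
  split_ifs with h
  · rfl
  · simp [lev_int _ w 0 0 (by simp)]

lemma bm_one {w : GW} (hw : WW w ≠ ⊤) : bm w 1 = w (0, 0) := by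
  unfold bm
  rw [if_neg hw]
  have : ∀ n, lev n w 1 = 0 := fun n => lev_int n w 1 (2 ^ n) (by simp)
  simp [this]

noncomputable def domi (w : GW) : ℝ := |w (0, 0)| + (∑' n, aa n) + (WW w).toReal

lemma integrable_coord (i : ℕ × ℕ) : Integrable (fun w : GW => w i) gP :=
  (coord_mp i).integrable_comp_of_integrable
    ((ProbabilityTheory.memLp_id_gaussianReal (μ := 0) (v := 1) 1).integrable (by norm_num))

lemma integrable_domi : Integrable domi gP :=
  ((integrable_coord _).abs.add (integrable_const _)).add
    (integrable_toReal_of_lintegral_ne_top measurable_WW.aemeasurable lintegral_WW.ne)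

lemma bm_le_domi (w : GW) (u : ℝ≥0) (hu : u ≤ 1) : |bm w u| ≤ domi w := by
  have ha : 0 ≤ ∑' n, aa n := tsum_nonneg fun n => (aa_pos n).le
  have hu' : (u : ℝ) ≤ 1 := by exact_mod_cast hu
  unfold bm domi
  split_ifs with h
  · rw [abs_zero]; positivity
  · refine (abs_add_le _ _).trans ?_
    rw [add_assoc]
    refine add_le_add ?_ ?_
    · rw [abs_mul, abs_of_nonneg (NNReal.coe_nonneg u)]
      exact mul_le_of_le_one_left (abs_nonneg _) hu'
    · rw [← tsum_ee h, ← summable_aa.tsum_add (summable_ee h)]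
      exact tsum_of_norm_bounded (f := fun n => lev n w u)
        (summable_aa.add (summable_ee h)).hasSum fun n => lev_le n w u

lemma bm_one_ne : gP {w | bm w 1 = 0} = 0 := by
  have h1 : gP {w : GW | w (0, 0) = 0} = 0 := by
    have := (coord_mp (0, 0)).measure_preimage (measurableSet_singleton (0 : ℝ)).nullMeasurableSet
    have h2 : (ProbabilityTheory.gaussianReal 0 1) {(0 : ℝ)} = 0 := by
      have := ProbabilityTheory.nullSingletonClass_gaussianReal (μ := 0) (v := 1) one_ne_zero
      exact measure_singleton 0
    rw [h2] at this
    exact this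
  have h3 : ∀ᵐ w ∂gP, bm w 1 ≠ 0 := by
    filter_upwards [ae_good, (measure_eq_zero_iff_ae_notMem.1 h1)] with w hw hw2
    rw [bm_one hw]; exact hw2
  rw [measure_eq_zero_iff_ae_notMem]
  exact h3


/-- Dyadic points. -/
noncomputable def dy (m k : ℕ) : ℝ≥0 := k / 2 ^ m

/-- The coordinates used up to level `m`. -/
def J (m : ℕ) : Finset (ℕ × ℕ) :=
  (Finset.range (m + 1) ×ˢ Finset.range (2 ^ m)).filter fun i => i.2 < 2 ^ (i.1 - 1)

lemma sum_J (m : ℕ) (g : ℕ × ℕ → ℝ) :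
    ∑ i ∈ J m, g i = g (0, 0) + ∑ n ∈ Finset.range m, ∑ k ∈ Finset.range (2 ^ n), g (n + 1, k) := by
  unfold J
  rw [Finset.sum_filter, Finset.sum_product, Finset.sum_range_succ', add_comm]
  congr 1
  · rw [← Finset.sum_filter]
    have : (Finset.range (2 ^ m)).filter (fun k => k < 2 ^ (0 - 1)) = {0} := by
      ext k
      have : 0 < 2 ^ m := by positivity
      simp
    rw [this, Finset.sum_singleton]
  · refine Finset.sum_congr rfl fun n hn => ?_
    rw [← Finset.sum_filter]
    refine Finset.sum_congr ?_ fun _ _ => rfl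
    ext k
    simp only [Finset.mem_filter, Finset.mem_range, Nat.add_sub_cancel, and_iff_right_iff_imp]
    intro hk
    exact hk.trans_le (Nat.pow_le_pow_right (by norm_num) (Finset.mem_range.1 hn).le)

noncomputable def psi (u : ℝ≥0) : ℕ × ℕ → ℝ
  | (0, _) => u
  | (n + 1, k) => cc n * hat (2 ^ n * u - k)

lemma bm_dyadic {w : GW} (hw : WW w ≠ ⊤) (m : ℕ) (u : ℝ≥0) (j : ℤ) (h : (2 : ℝ) ^ m * u = j) :
    bm w u = ∑ i ∈ J m, psi u i * w i := by
  rw [sum_J, bm, if_neg hw]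
  congr 1
  rw [tsum_eq_sum (s := Finset.range m)]
  · refine Finset.sum_congr rfl fun n _ => ?_
    rw [lev, Finset.mul_sum]
    refine Finset.sum_congr rfl fun k _ => ?_
    rw [psi]; ring
  · intro n hn
    simp only [Finset.mem_range, not_lt] at hn
    apply lev_int n w u (2 ^ (n - m) * j)
    push_cast
    rw [← h, ← mul_assoc, ← pow_add, Nat.sub_add_cancel hn]

lemma psi_cov (m : ℕ) (s t : ℝ≥0) (hs : s ≤ 1) (ht : t ≤ 1) (j : ℤ) (h : (2 : ℝ) ^ m * s = j) :
    ∑ i ∈ J m, psi s i * psi t i = min (s : ℝ) t := by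
  have := hR_eq m s t s.coe_nonneg (by exact_mod_cast hs) t.coe_nonneg
    (by exact_mod_cast ht) ⟨j, h⟩
  rw [sum_J]
  have e : ∑ n ∈ Finset.range m, ∑ k ∈ Finset.range (2 ^ n), psi s (n + 1, k) * psi t (n + 1, k)
      = hR m s t := by
    unfold hR hT
    refine Finset.sum_congr rfl fun n _ => ?_
    rw [← cc_sq, Finset.mul_sum]
    refine Finset.sum_congr rfl fun k _ => ?_
    simp only [psi]; ring
  rw [e, this]
  simp only [psi]; ring

lemma integral_coord (i : ℕ × ℕ) : ∫ w : GW, w i ∂gP = 0 := by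
  have := (coord_mp i).map_eq
  rw [show (0 : ℝ) = ∫ x, x ∂(ProbabilityTheory.gaussianReal 0 1) by
    rw [ProbabilityTheory.integral_id_gaussianReal], ← this,
    integral_map (coord_mp i).measurable.aemeasurable (by fun_prop)]

lemma memLp_coord (i : ℕ × ℕ) : MemLp (fun w : GW => w i) 2 gP :=
  (ProbabilityTheory.memLp_id_gaussianReal (μ := 0) (v := 1) 2).comp_measurePreserving (coord_mp i)

lemma indep_coord : ProbabilityTheory.iIndepFun (fun (i : ℕ × ℕ) (w : GW) => w i) gP :=
  ProbabilityTheory.iIndepFun_infinitePi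
    (P := fun _ : ℕ × ℕ => ProbabilityTheory.gaussianReal 0 1) (X := fun _ x => x)
    (fun _ => measurable_id)

lemma cov_coord (i k : ℕ × ℕ) :
    ProbabilityTheory.covariance (fun w : GW => w i) (fun w : GW => w k) gP
      = if i = k then 1 else 0 := by
  split_ifs with h
  · subst h
    rw [ProbabilityTheory.covariance_self (measurable_pi_apply i).aemeasurable]
    have h1 : ProbabilityTheory.variance (fun x : ℝ => x) (Measure.map (fun w : GW => w i) gP) = 1 := by
      rw [(coord_mp i).map_eq]
      simp
    rw [ProbabilityTheory.variance_map (X := fun x : ℝ => x) (Y := fun w : GW => w i)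
      (by fun_prop) (measurable_pi_apply i).aemeasurable] at h1
    exact h1
  · exact (indep_coord.indepFun h).covariance_eq_zero (memLp_coord _) (memLp_coord _)

lemma cov_sum (I : Finset (ℕ × ℕ)) (a b : ℕ × ℕ → ℝ) :
    ProbabilityTheory.covariance (fun w : GW => ∑ i ∈ I, a i * w i)
      (fun w : GW => ∑ i ∈ I, b i * w i) gP = ∑ i ∈ I, a i * b i := by
  rw [ProbabilityTheory.covariance_fun_sum_fun_sum' (fun i _ => (memLp_coord i).const_mul _)
    (fun i _ => (memLp_coord i).const_mul _)]
  refine Finset.sum_congr rfl fun i hi => ?_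
  simp_rw [ProbabilityTheory.covariance_const_mul_left, ProbabilityTheory.covariance_const_mul_right,
    cov_coord]
  simp [hi]

lemma gauss_coord : ProbabilityTheory.IsGaussianProcess (fun (i : ℕ × ℕ) (w : GW) => w i) gP where
  hasGaussianLaw I := by
    have h := indep_coord.precomp (g := fun i : I => (i : ℕ × ℕ)) Subtype.val_injective
    have := h.hasGaussianLaw (fun i => by
      constructor
      have := (coord_mp i).map_eq
      change ProbabilityTheory.IsGaussian (Measure.map (fun w : GW => w i) gP)
      rw [this]; infer_instance)
    exact this


lemma gauss_of_ae {S : Type*} (Z : S → GW → ℝ)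
    (h : ∀ s, ∃ (I : Finset (ℕ × ℕ)) (a : ℕ × ℕ → ℝ), Z s =ᵐ[gP] fun w => ∑ i ∈ I, a i * w i) :
    ProbabilityTheory.IsGaussianProcess Z gP := by
  choose I a h using h
  have : ProbabilityTheory.IsGaussianProcess (fun s (w : GW) => ∑ i ∈ I s, a s i * w i) gP := by
    refine gauss_coord.of_isGaussianProcess fun s => ⟨I s, ∑ i : I s, a s i •
      ContinuousLinearMap.proj (R := ℝ) (φ := fun _ : I s => ℝ) i, fun w => ?_⟩
    simp only [sum_apply, smul_apply,
      ContinuousLinearMap.proj_apply, Finset.restrict, smul_eq_mul]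
    rw [← Finset.sum_coe_sort (I s)]
  exact this.congr fun s => (h s).symm

/-- `u` is dyadic of level `m`. -/
def Dya (m : ℕ) (u : ℝ≥0) : Prop := ∃ j : ℤ, (2 : ℝ) ^ m * u = j

lemma Dya.mono {m n : ℕ} {u : ℝ≥0} (h : Dya m u) (hmn : m ≤ n) : Dya n u := by
  obtain ⟨j, hj⟩ := h
  refine ⟨2 ^ (n - m) * j, ?_⟩
  push_cast
  rw [← hj, ← mul_assoc, ← pow_add, Nat.sub_add_cancel hmn]

lemma dya_dy (m k : ℕ) : Dya m (dy m k) := by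
  refine ⟨k, ?_⟩
  simp [dy]
  field_simp

lemma Dya.ae {m : ℕ} {u : ℝ≥0} (h : Dya m u) :
    (fun w => bm w u) =ᵐ[gP] fun w => ∑ i ∈ J m, psi u i * w i := by
  obtain ⟨j, hj⟩ := h
  filter_upwards [ae_good] with w hw using bm_dyadic hw m u j hj

lemma Dya.ae_sub {m : ℕ} {u v : ℝ≥0} (h : Dya m u) (h' : Dya m v) :
    (fun w => bm w u - bm w v) =ᵐ[gP] fun w => ∑ i ∈ J m, (psi u i - psi v i) * w i := by
  filter_upwards [h.ae, h'.ae] with w hw hw'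
  rw [hw, hw', ← Finset.sum_sub_distrib]
  simp [sub_mul]

lemma cov_inc (m : ℕ) {u s t : ℝ≥0} (hu : Dya m u) (hs : Dya m s) (ht : Dya m t)
    (hus : u ≤ s) (hst : s ≤ t) (ht1 : t ≤ 1) :
    ProbabilityTheory.covariance (fun w => bm w u) (fun w => bm w t - bm w s) gP = 0 := by
  have e := cov_sum (J m) (psi u) (fun i => psi t i - psi s i)
  have e2 : ProbabilityTheory.covariance (fun w => bm w u) (fun w => bm w t - bm w s) gP
      = ProbabilityTheory.covariance (fun w : GW => ∑ i ∈ J m, psi u i * w i)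
      (fun w : GW => ∑ i ∈ J m, (psi t i - psi s i) * w i) gP := by
    unfold ProbabilityTheory.covariance
    rw [integral_congr_ae hu.ae, integral_congr_ae (ht.ae_sub hs)]
    apply integral_congr_ae
    filter_upwards [hu.ae, ht.ae_sub hs] with w h1 h2
    rw [h1, h2]
  rw [e2, e]
  simp_rw [mul_sub]
  obtain ⟨j, hj⟩ := hu
  rw [Finset.sum_sub_distrib, psi_cov m u t (hus.trans (hst.trans ht1)) ht1 j hj,
    psi_cov m u s (hus.trans (hst.trans ht1)) (hst.trans ht1) j hj,
    min_eq_left (by exact_mod_cast hus.trans hst), min_eq_left (by exact_mod_cast hus), sub_self]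

lemma dya_min {m n : ℕ} {u v : ℝ≥0} (hu : Dya m u) (hv : Dya n v) : Dya (max m n) (min u v) := by
  rcases min_choice u v with h | h <;> rw [h]
  · exact hu.mono (le_max_left _ _)
  · exact hv.mono (le_max_right _ _)

lemma indep_inc (m : ℕ) {s t : ℝ≥0} (hs : Dya m s) (ht : Dya m t) (hst : s ≤ t) (ht1 : t ≤ 1) :
    ProbabilityTheory.IndepFun (fun w (i : ℕ × ℕ) => bm w (min (dy i.1 i.2) s))
      (fun w => bm w t - bm w s) gP := by
  have key : ProbabilityTheory.IndepFun (fun w (i : ℕ × ℕ) => bm w (min (dy i.1 i.2) s))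
      (fun w (_ : Unit) => bm w t - bm w s) gP := by
    refine ProbabilityTheory.IsGaussianProcess.indepFun_of_covariance_eq_zero
      (X := fun (i : ℕ × ℕ) w => bm w (min (dy i.1 i.2) s))
      (Y := fun (_ : Unit) w => bm w t - bm w s) (gauss_of_ae _ ?_)
      (fun i => (measurable_bm _).aemeasurable)
      (fun i => ((measurable_bm _).sub (measurable_bm _)).aemeasurable) ?_
    · rintro (i | i)
      · exact ⟨_, _, (dya_min (dya_dy i.1 i.2) hs).ae⟩
      · exact ⟨_, _, ht.ae_sub hs⟩
    · intro i _
      exact cov_inc (max i.1 m) (dya_min (dya_dy i.1 i.2) hs) (hs.mono (le_max_right _ _))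
        (ht.mono (le_max_right _ _)) (min_le_right _ _) hst ht1
  exact key.comp measurable_id (measurable_pi_apply ())

lemma integral_inc (m : ℕ) {s t : ℝ≥0} (hs : Dya m s) (ht : Dya m t) :
    ∫ w, (bm w t - bm w s) ∂gP = 0 := by
  rw [integral_congr_ae (ht.ae_sub hs), integral_finsetSum]
  · refine Finset.sum_eq_zero fun i _ => ?_
    rw [integral_const_mul, integral_coord, mul_zero]
  · exact fun i _ => (integrable_coord i).const_mul _

/-- Left dyadic approximation. -/
lemma tendsto_dy_floor (u : ℝ≥0) : Tendsto (fun l => dy l ⌊2 ^ l * (u : ℝ)⌋₊) atTop (𝓝 u) := by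
  have h := (tendsto_nat_floor_mul_div_atTop (R := ℝ) (a := u) u.coe_nonneg).comp
    (tendsto_pow_atTop_atTop_of_one_lt (r := (2 : ℝ)) (by norm_num))
  rw [← NNReal.tendsto_coe]
  refine h.congr fun l => ?_
  simp only [Function.comp, dy]
  push_cast
  rw [mul_comm]

/-- The natural filtration of the Brownian motion. -/
noncomputable def GG : Filtration ℝ≥0 (inferInstance : MeasurableSpace GW) :=
  Filtration.natural (fun u w => bm w u) fun u => (measurable_bm u).stronglyMeasurable

lemma GG_le (s : ℝ≥0) :
    GG s ≤ MeasurableSpace.comap (fun w (i : ℕ × ℕ) => bm w (min (dy i.1 i.2) s)) inferInstance := by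
  refine iSup₂_le fun u hu => ?_
  rw [← measurable_iff_comap_le]
  refine @measurable_of_tendsto_metrizable _ _ (_) _ _ _ _
    (fun l w => bm w (min (dy l ⌊2 ^ l * (u : ℝ)⌋₊) s)) _ (fun l => ?_) ?_
  · exact (measurable_pi_apply (X := fun _ : ℕ × ℕ => ℝ) (l, ⌊2 ^ l * (u : ℝ)⌋₊)).comp
      (comap_measurable (fun w (i : ℕ × ℕ) => bm w (min (dy i.1 i.2) s)))
  · rw [tendsto_pi_nhds]
    intro w
    have := (tendsto_dy_floor u).min (tendsto_const_nhds (x := s))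
    rw [min_eq_left hu] at this
    exact ((continuous_bm w).tendsto u).comp this

lemma mart (m : ℕ) {s t : ℝ≥0} (hs : Dya m s) (ht : Dya m t) (hst : s ≤ t) (ht1 : t ≤ 1)
    (Y : GW → ℝ) (hY : Measurable[GG s] Y) : ∫ w, Y w * (bm w t - bm w s) ∂gP = 0 := by
  have h : ProbabilityTheory.IndepFun Y (fun w => bm w t - bm w s) gP := by
    have := indep_inc m hs ht hst ht1
    rw [ProbabilityTheory.IndepFun_iff_Indep] at this ⊢
    exact ProbabilityTheory.indep_of_indep_of_le_left this (hY.comap_le.trans (GG_le s))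
  rw [h.integral_fun_mul_eq_mul_integral (hY.mono (GG.le s) le_rfl).aestronglyMeasurable
    ((measurable_bm _).sub (measurable_bm _)).aestronglyMeasurable, integral_inc m hs ht, mul_zero]


lemma tendsto_dy_ceil (u : ℝ≥0) : Tendsto (fun l => dy l ⌈2 ^ l * (u : ℝ)⌉₊) atTop (𝓝 u) := by
  have h := (tendsto_nat_ceil_mul_div_atTop (R := ℝ) (a := u) u.coe_nonneg).comp
    (tendsto_pow_atTop_atTop_of_one_lt (r := (2 : ℝ)) (by norm_num))
  rw [← NNReal.tendsto_coe]
  refine h.congr fun l => ?_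
  simp only [Function.comp, dy]
  push_cast
  rw [mul_comm]

lemma le_dy_iff (u : ℝ≥0) (m k : ℕ) : u ≤ dy m k ↔ ⌈2 ^ m * (u : ℝ)⌉₊ ≤ k := by
  rw [Nat.ceil_le, ← NNReal.coe_le_coe, dy]
  push_cast
  rw [le_div_iff₀ (by positivity), mul_comm]

lemma dy_lt_iff (u : ℝ≥0) (m k : ℕ) : dy m k < u ↔ k < ⌈2 ^ m * (u : ℝ)⌉₊ := by
  rw [← not_le, le_dy_iff, not_le]

lemma ceil_le_pow {u : ℝ≥0} (hu : u ≤ 1) (m : ℕ) : ⌈2 ^ m * (u : ℝ)⌉₊ ≤ 2 ^ m := by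
  rw [Nat.ceil_le]
  push_cast
  have : (u : ℝ) ≤ 1 := by exact_mod_cast hu
  exact mul_le_of_le_one_right (by positivity) this

lemma dy_mono (m : ℕ) {j k : ℕ} (h : j ≤ k) : dy m j ≤ dy m k := by
  unfold dy; gcongr

lemma dy_le_one {m k : ℕ} (h : k ≤ 2 ^ m) : dy m k ≤ 1 := by
  unfold dy
  rw [div_le_one (by positivity)]
  exact_mod_cast h

lemma tele (f : ℕ → ℝ) (a : ℝ) (i j N : ℕ) (hij : i ≤ j) (hj : j ≤ N) :
    ∑ k ∈ Finset.range N, (if i ≤ k ∧ k < j then a else 0) * (f (k + 1) - f k)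
      = a * (f j - f i) := by
  simp_rw [ite_mul, zero_mul]
  rw [← Finset.sum_filter]
  have : (Finset.range N).filter (fun k => i ≤ k ∧ k < j) = Finset.Ico i j := by
    ext k; simp; omega
  rw [this, ← Finset.mul_sum, Finset.sum_Ico_eq_sub _ hij, Finset.sum_range_sub,
    Finset.sum_range_sub]
  ring

lemma opt (τ τ' : GW → ℝ≥0) (hle : ∀ w, τ w ≤ τ' w) (h1 : ∀ w, τ' w ≤ 1) (h : GW → ℝ) (C : ℝ)
    (hC : ∀ w, |h w| ≤ C)
    (hm : ∀ m k, k < 2 ^ m → Measurable[GG (dy m k)]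
      fun w => if τ w ≤ dy m k ∧ dy m k < τ' w then h w else 0) :
    Integrable (fun w => h w * (bm w (τ' w) - bm w (τ w))) gP ∧
      ∫ w, h w * (bm w (τ' w) - bm w (τ w)) ∂gP = 0 := by
  classical
  set H : ℕ → ℕ → GW → ℝ := fun m k w => if τ w ≤ dy m k ∧ dy m k < τ' w then h w else 0 with hH
  set T : ℕ → GW → ℝ := fun m w =>
    ∑ k ∈ Finset.range (2 ^ m), H m k w * (bm w (dy m (k + 1)) - bm w (dy m k)) with hT
  have hTe : ∀ m w, T m w = h w * (bm w (dy m ⌈2 ^ m * (τ' w : ℝ)⌉₊)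
      - bm w (dy m ⌈2 ^ m * (τ w : ℝ)⌉₊)) := by
    intro m w
    rw [hT]
    simp only [hH, le_dy_iff, dy_lt_iff]
    refine tele (fun k => bm w (dy m k)) (h w) _ _ _ ?_ (ceil_le_pow (h1 w) m)
    exact Nat.ceil_mono (by have := hle w; gcongr)
  have hHm : ∀ m k, k < 2 ^ m → Measurable (H m k) := fun m k hk =>
    (hm m k hk).mono (GG.le _) le_rfl
  have hTm : ∀ m, Measurable (T m) := fun m =>
    Finset.measurable_sum _ fun k hk => (hHm m k (Finset.mem_range.1 hk)).mul
      ((measurable_bm _).sub (measurable_bm _))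
  have hlim : ∀ w, Tendsto (fun m => T m w) atTop (𝓝 (h w * (bm w (τ' w) - bm w (τ w)))) := by
    intro w
    simp_rw [hTe]
    exact ((((continuous_bm w).tendsto _).comp (tendsto_dy_ceil (τ' w))).sub
      (((continuous_bm w).tendsto _).comp (tendsto_dy_ceil (τ w)))).const_mul _
  have hb2 : ∀ w (u v : ℝ≥0), u ≤ 1 → v ≤ 1 → |h w * (bm w u - bm w v)| ≤ C * (2 * domi w) := by
    intro w u v hu hv
    rw [abs_mul]
    have h3 : |bm w u - bm w v| ≤ 2 * domi w := by
      refine (abs_sub _ _).trans ?_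
      linarith [bm_le_domi w u hu, bm_le_domi w v hv]
    exact mul_le_mul (hC w) h3 (abs_nonneg _) ((abs_nonneg _).trans (hC w))
  have hbi : Integrable (fun w => C * (2 * domi w)) gP := (integrable_domi.const_mul _).const_mul _
  have hTb : ∀ m w, |T m w| ≤ C * (2 * domi w) := fun m w => by
    rw [hTe]
    exact hb2 _ _ _ (dy_le_one (ceil_le_pow (h1 w) m))
      (dy_le_one (ceil_le_pow ((hle w).trans (h1 w)) m))
  have hT0 : ∀ m, ∫ w, T m w ∂gP = 0 := by
    intro m
    rw [hT, integral_finsetSum]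
    · refine Finset.sum_eq_zero fun k hk => ?_
      have hk := Finset.mem_range.1 hk
      exact mart m (dya_dy m k) (dya_dy m (k + 1)) (dy_mono m (by omega)) (dy_le_one hk) _
        (hm m k hk)
    · intro k hk
      have hk := Finset.mem_range.1 hk
      refine Integrable.mono' hbi ((hHm m k hk).mul
        ((measurable_bm _).sub (measurable_bm _))).aestronglyMeasurable (ae_of_all _ fun w => ?_)
      simp only [hH]
      split_ifs
      · exact hb2 _ _ _ (dy_le_one hk) (dy_le_one hk.le)
      · rw [zero_mul, norm_zero]
        exact (abs_nonneg _).trans (hTb 0 w)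
  have hmeas : Measurable (fun w => h w * (bm w (τ' w) - bm w (τ w))) :=
    measurable_of_tendsto_metrizable hTm (tendsto_pi_nhds.2 hlim)
  refine ⟨Integrable.mono' hbi hmeas.aestronglyMeasurable
    (ae_of_all _ fun w => hb2 _ _ _ (h1 w) ((hle w).trans (h1 w))), ?_⟩
  have := tendsto_integral_of_dominated_convergence (μ := gP) (F := T) _
    (fun m => (hTm m).aestronglyMeasurable) hbi (fun m => ae_of_all _ fun w => hTb m w)
    (ae_of_all _ hlim)
  simp_rw [hT0] at this
  exact (tendsto_nhds_unique this tendsto_const_nhds)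


/-- The stopping time: first exit of `(-a, a)`, capped by `1`. -/
noncomputable def sig (a : ℝ) (w : GW) : ℝ≥0 := sInf {u : ℝ≥0 | 1 ≤ u ∨ a ≤ |bm w u|}

lemma sig_le_one (a : ℝ) (w : GW) : sig a w ≤ 1 :=
  csInf_le (OrderBot.bddBelow _) (Or.inl le_rfl)

lemma sig_mem (a : ℝ) (w : GW) : 1 ≤ sig a w ∨ a ≤ |bm w (sig a w)| := by
  have hc : IsClosed {u : ℝ≥0 | 1 ≤ u ∨ a ≤ |bm w u|} :=
    (isClosed_le continuous_const continuous_id).union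
      (isClosed_le continuous_const (continuous_bm w).abs)
  exact hc.csInf_mem ⟨1, Or.inl le_rfl⟩ (OrderBot.bddBelow _)

lemma lt_of_lt_sig {a : ℝ} {w : GW} {u : ℝ≥0} (h : u < sig a w) : |bm w u| < a := by
  have := notMem_of_lt_csInf h (OrderBot.bddBelow _)
  simp only [Set.mem_ofPred_eq, not_or, not_le] at this
  exact this.2

lemma lt_sig_iff {a : ℝ} {w : GW} {s : ℝ≥0} (hs : s < 1) :
    s < sig a w ↔ ∃ n : ℕ, ∀ i : ℕ,
      |bm w (min (TopologicalSpace.denseSeq ℝ≥0 i) s)| ≤ a - 1 / (n + 1) := by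
  have hcont : Continuous fun v : ℝ≥0 => |bm w (min v s)| :=
    ((continuous_bm w).comp (by fun_prop)).abs
  constructor
  · intro h
    obtain ⟨x, hx, hmax⟩ := (isCompact_Icc (a := (0 : ℝ≥0)) (b := s)).exists_isMaxOn
      ⟨0, by simp⟩ hcont.continuousOn
    have hx2 : |bm w (min x s)| < a := lt_of_lt_sig ((min_le_right _ _).trans_lt h)
    obtain ⟨n, hn⟩ := exists_nat_one_div_lt (sub_pos.2 hx2)
    refine ⟨n, fun i => ?_⟩
    have := hmax (a := min (TopologicalSpace.denseSeq ℝ≥0 i) s) ⟨by simp, by simp⟩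
    simp only [Set.mem_ofPred_eq, min_assoc, min_self] at this
    linarith
  · rintro ⟨n, hn⟩
    have hall : ∀ v : ℝ≥0, |bm w (min v s)| ≤ a - 1 / (n + 1) := by
      intro v
      have hcl : IsClosed {v : ℝ≥0 | |bm w (min v s)| ≤ a - 1 / (n + 1)} :=
        isClosed_le hcont continuous_const
      have hd := TopologicalSpace.denseRange_denseSeq ℝ≥0
      have : Set.range (TopologicalSpace.denseSeq ℝ≥0) ⊆
          {v : ℝ≥0 | |bm w (min v s)| ≤ a - 1 / (n + 1)} := by
        rintro _ ⟨i, rfl⟩; exact hn i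
      exact hcl.closure_subset_iff.2 this (hd v)
    by_contra hlt
    rw [not_lt] at hlt
    rcases sig_mem a w with h | h
    · exact absurd (h.trans hlt) (not_le.2 hs)
    · have h2 := hall (sig a w)
      rw [min_eq_left hlt] at h2
      have : (0 : ℝ) < 1 / (n + 1) := by positivity
      linarith

lemma measurable_bm_GG {u s : ℝ≥0} (h : u ≤ s) : Measurable[GG s] fun w => bm w u := by
  have h1 : StronglyMeasurable[GG u] fun w => bm w u :=
    Filtration.stronglyAdapted_natural (u := fun u w => bm w u)
      (fun u => (measurable_bm u).stronglyMeasurable) u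
  exact h1.measurable.mono (GG.mono h) le_rfl

lemma meas_sig (a : ℝ) (s : ℝ≥0) : MeasurableSet[GG s] {w | sig a w ≤ s} := by
  rcases le_or_gt 1 s with hs | hs
  · have : {w | sig a w ≤ s} = Set.univ := by
      ext w; simp [(sig_le_one a w).trans hs]
    rw [this]; exact MeasurableSet.univ
  · have : {w | sig a w ≤ s} = (⋃ n : ℕ, ⋂ i : ℕ,
        {w | |bm w (min (TopologicalSpace.denseSeq ℝ≥0 i) s)| ≤ a - 1 / (n + 1)})ᶜ := by
      ext w
      rw [Set.mem_compl_iff, Set.mem_ofPred_eq, ← not_lt, lt_sig_iff hs]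
      simp
    rw [this]
    refine MeasurableSet.compl (MeasurableSet.iUnion fun n => MeasurableSet.iInter fun i => ?_)
    have := measurable_bm_GG (min_le_right (TopologicalSpace.denseSeq ℝ≥0 i) s)
    exact (measurable_norm.comp this) measurableSet_Iic

/-- The stopped path. -/
noncomputable def XX (a : ℝ) (w : GW) : Omega :=
  ⟨fun u => bm w (min u (sig a w)), (continuous_bm w).comp (by fun_prop)⟩

lemma measurable_XX_apply (a : ℝ) (u : ℝ≥0) : Measurable[GG u] fun w => (XX a w).1 u := by
  have h1 : Measurable[GG u] fun w => min u (sig a w) := by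
    refine measurable_of_Iic fun v => ?_
    rcases le_or_gt u v with h | h
    · have : (fun w => min u (sig a w)) ⁻¹' Set.Iic v = Set.univ := by
        ext w; simp [h]
      rw [this]; exact MeasurableSet.univ
    · have : (fun w => min u (sig a w)) ⁻¹' Set.Iic v = {w | sig a w ≤ v} := by
        ext w; simp [not_le.2 h]
      rw [this]; exact GG.mono h.le _ (meas_sig a v)
  have h2 := measurable_uncurry_of_continuous_of_measurable (m := GG u)
    (u := fun (v : ℝ≥0) w => bm w (min v u)) (fun w => (continuous_bm w).comp (by fun_prop))
    (fun v => measurable_bm_GG (min_le_right _ _))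
  have h3 := h2.comp (h1.prodMk measurable_id)
  convert h3 using 2 with w
  simp only [XX, Function.comp, Function.uncurry, id]
  congr 1
  exact (min_eq_left (min_le_left _ _)).symm

lemma measurable_XX (a : ℝ) (s : ℝ≥0) : @Measurable _ _ (GG s) (F s) (XX a) := by
  rw [measurable_iff_comap_le, F, MeasurableSpace.comap_iSup]
  refine iSup_le fun u => ?_
  rw [MeasurableSpace.comap_comp, ← measurable_iff_comap_le]
  exact (measurable_XX_apply a u.1).mono (GG.mono u.2) le_rfl

lemma XX_mem (a : ℝ) (ha : 0 < a) (w : GW) (hw : a ≤ |bm w 1|) :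
    XX a w ∈ {ω : Omega | ∃ t : ℝ≥0, 0 < t ∧
        (RayOfLocalExt (· ≤ ·) ω t ∨ RayOfLocalExt (· ≥ ·) ω t)} := by
  have hσ : a ≤ |bm w (sig a w)| := by
    rcases sig_mem a w with h | h
    · rwa [le_antisymm (sig_le_one a w) h]
    · exact h
  have hX : ∀ u, sig a w ≤ u → (XX a w).1 u = bm w (sig a w) := fun u hu => by
    simp only [XX]; rw [min_eq_right hu]
  have hX2 : ∀ u, u < sig a w → (XX a w).1 u = bm w u := fun u hu => by
    simp only [XX]; rw [min_eq_left hu.le]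
  have h1 : ∀ u : ℝ≥0, sig a w ≤ u → (XX a w).1 u = (XX a w).1 (sig a w) := fun u hu => by
    rw [hX u hu, hX _ le_rfl]
  have h2 : ¬ ∃ s : ℝ≥0, 0 < s ∧ s < sig a w ∧
      ∀ u : ℝ≥0, s ≤ u → (XX a w).1 u = (XX a w).1 (sig a w) := by
    rintro ⟨s, _, hs, h⟩
    have := h s le_rfl
    rw [hX2 s hs, hX _ le_rfl] at this
    have h3 := lt_of_lt_sig hs
    rw [this] at h3
    linarith
  refine ⟨sig a w, ?_, ?_⟩
  · rw [pos_iff_ne_zero]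
    intro h0
    rw [h0, bm_zero, abs_zero] at hσ
    linarith
  · rcases le_or_gt 0 (bm w (sig a w)) with h | h
    · left
      refine ⟨h1, h2, 1, one_pos, fun s _ hs => ?_⟩
      rw [hX2 s hs, hX _ le_rfl]
      have := (abs_lt.1 (lt_of_lt_sig hs)).2
      rw [abs_of_nonneg h] at hσ
      linarith
    · right
      refine ⟨h1, h2, 1, one_pos, fun s _ hs => ?_⟩
      rw [hX2 s hs, hX _ le_rfl]
      have := (abs_lt.1 (lt_of_lt_sig hs)).1
      rw [abs_of_neg h] at hσ
      change bm w (sig a w) ≤ bm w s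
      linarith


/-- Partial capital at time `1`. -/
noncomputable def part (G : ElemStrategy) (c : ℝ) (N : ℕ) (ω : Omega) : ℝ :=
  c + ∑ n ∈ Finset.range N,
    G.h n ω * (ω.1 (clip (G.τ (n + 1)) 1 ω) - ω.1 (clip (G.τ n) 1 ω))

lemma tau_mono (G : ElemStrategy) (ω : Omega) : Monotone fun n => G.τ n ω :=
  monotone_nat_of_le_succ fun n => G.mono n ω

lemma coe_clip (τ : Omega → ℝ≥0∞) (t : ℝ≥0) (ω : Omega) :
    ((clip τ t ω : ℝ≥0) : ℝ≥0∞) = min (τ ω) t :=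
  ENNReal.coe_toNNReal ((min_le_right _ _).trans_lt ENNReal.coe_lt_top).ne

lemma clip_eq_of_le {τ : Omega → ℝ≥0∞} {t : ℝ≥0} {ω : Omega} (h : (t : ℝ≥0∞) ≤ τ ω) :
    clip τ t ω = t := by
  rw [← ENNReal.coe_inj, coe_clip, min_eq_right h]

lemma part_eq (G : ElemStrategy) (c : ℝ) (N : ℕ) (ω : Omega) :
    part G c N ω = elemCapital G c (clip (G.τ N) 1 ω) ω := by
  unfold part elemCapital
  congr 1
  rw [tsum_eq_sum (s := Finset.range N)]
  · refine Finset.sum_congr rfl fun n hn => ?_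
    have key : ∀ k ≤ N, clip (G.τ k) (clip (G.τ N) 1 ω) ω = clip (G.τ k) 1 ω := by
      intro k hk
      rw [← ENNReal.coe_inj, coe_clip, coe_clip, coe_clip, ← min_assoc,
        min_eq_left (tau_mono G ω hk)]
    have hn := Finset.mem_range.1 hn
    rw [key n hn.le, key (n + 1) hn]
  · intro n hn
    simp only [Finset.mem_range, not_lt] at hn
    have key : ∀ k ≥ N, clip (G.τ k) (clip (G.τ N) 1 ω) ω = clip (G.τ N) 1 ω := by
      intro k hk
      apply clip_eq_of_le
      rw [coe_clip]
      exact (min_le_left _ _).trans (tau_mono G ω hk)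
    rw [key n hn, key (n + 1) (by omega), sub_self, mul_zero]

lemma part_tendsto (G : ElemStrategy) (c : ℝ) (ω : Omega) :
    Tendsto (fun N => part G c N ω) atTop (𝓝 (elemCapital G c 1 ω)) := by
  apply tendsto_const_nhds.congr'
  have h := (G.tendsto_top ω).eventually (lt_mem_nhds (ENNReal.coe_lt_top (r := 1)))
  filter_upwards [h] with N hN
  rw [part_eq, clip_eq_of_le hN.le]

lemma XX_clip (a : ℝ) (w : GW) (τ : Omega → ℝ≥0∞) :
    (XX a w).1 (clip τ 1 (XX a w)) = bm w (min (clip τ 1 (XX a w)) (sig a w)) := rfl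

lemma clip_le (τ : Omega → ℝ≥0∞) (t : ℝ≥0) (ω : Omega) : clip τ t ω ≤ t := by
  rw [← ENNReal.coe_le_coe, coe_clip]; exact min_le_right _ _

lemma clip_le_iff {τ : Omega → ℝ≥0∞} {s : ℝ≥0} {ω : Omega} (hs : s < 1) :
    clip τ 1 ω ≤ s ↔ τ ω ≤ s := by
  rw [← ENNReal.coe_le_coe, coe_clip, min_le_iff]
  refine or_iff_left ?_
  rw [not_le]; exact_mod_cast hs

lemma term_int (G : ElemStrategy) (a : ℝ) (n : ℕ) :
    Integrable (fun w => G.h n (XX a w) * ((XX a w).1 (clip (G.τ (n + 1)) 1 (XX a w))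
      - (XX a w).1 (clip (G.τ n) 1 (XX a w)))) gP ∧
    ∫ w, G.h n (XX a w) * ((XX a w).1 (clip (G.τ (n + 1)) 1 (XX a w))
      - (XX a w).1 (clip (G.τ n) 1 (XX a w))) ∂gP = 0 := by
  classical
  obtain ⟨C, hC⟩ := G.h_bdd n
  refine opt (fun w => min (clip (G.τ n) 1 (XX a w)) (sig a w))
    (fun w => min (clip (G.τ (n + 1)) 1 (XX a w)) (sig a w)) ?_ ?_ (fun w => G.h n (XX a w)) C
    (fun w => hC _) ?_
  · intro w
    refine min_le_min_right _ ?_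
    rw [← ENNReal.coe_le_coe, coe_clip, coe_clip]
    exact min_le_min_right _ (G.mono n _)
  · exact fun w => (min_le_left _ _).trans (clip_le _ _ _)
  · intro m k hk
    generalize hs : dy m k = s
    have hs1 : s < 1 := by
      rw [← hs, dy, div_lt_one (by positivity)]
      exact_mod_cast hk
    have hX := measurable_XX a s
    have hg : @Measurable _ _ (F s) _ (fun ω => if G.τ n ω ≤ s then G.h n ω else 0) := by
      intro B hB
      have h1 := G.h_meas n B hB s
      have h2 := (G.stopping n s).compl
      by_cases h0 : (0 : ℝ) ∈ B
      · convert h1.union h2 using 1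
        ext ω
        by_cases h : G.τ n ω ≤ s <;> simp [h, h0]
      · convert h1 using 1
        ext ω
        by_cases h : G.τ n ω ≤ s <;> simp [h, h0]
    have hA : MeasurableSet[GG s] ({w | G.τ (n + 1) (XX a w) ≤ s} ∪ {w | sig a w ≤ s})ᶜ :=
      ((hX (G.stopping (n + 1) s)).union (meas_sig a s)).compl
    have := (hg.comp hX).indicator hA
    convert this using 2 with w
    simp only [min_le_iff, clip_le_iff hs1, ← not_le, Set.indicator, Function.comp,
      Set.mem_compl_iff, Set.mem_union, Set.mem_ofPred_eq]
    by_cases h1 : G.τ n (XX a w) ≤ s <;> by_cases h2 : G.τ (n + 1) (XX a w) ≤ s <;>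
      by_cases h3 : sig a w ≤ s <;> simp [h1, h2, h3]

lemma part_int (G : ElemStrategy) (c a : ℝ) (N : ℕ) :
    Integrable (fun w => part G c N (XX a w)) gP ∧ ∫ w, part G c N (XX a w) ∂gP = c := by
  unfold part
  have h1 : Integrable (fun w => ∑ n ∈ Finset.range N,
    G.h n (XX a w) * ((XX a w).1 (clip (G.τ (n + 1)) 1 (XX a w))
      - (XX a w).1 (clip (G.τ n) 1 (XX a w)))) gP :=
    integrable_finsetSum _ fun n _ => (term_int G a n).1
  refine ⟨(integrable_const c).add h1, ?_⟩
  rw [integral_add (integrable_const c) h1, integral_finsetSum _ fun n _ => (term_int G a n).1,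
    Finset.sum_eq_zero fun n _ => (term_int G a n).2]
  simp

lemma cap_bound (G : ElemStrategy) (c a : ℝ) (h0 : ∀ t ω, 0 ≤ elemCapital G c t ω) :
    AEMeasurable (fun w => ENNReal.ofReal (elemCapital G c 1 (XX a w))) gP ∧
    ∫⁻ w, ENNReal.ofReal (elemCapital G c 1 (XX a w)) ∂gP ≤ ENNReal.ofReal c := by
  have hm : ∀ N, AEMeasurable (fun w => ENNReal.ofReal (part G c N (XX a w))) gP := fun N =>
    (part_int G c a N).1.aemeasurable.ennreal_ofReal
  have ht : ∀ w, Tendsto (fun N => ENNReal.ofReal (part G c N (XX a w))) atTop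
      (𝓝 (ENNReal.ofReal (elemCapital G c 1 (XX a w)))) := fun w =>
    ENNReal.tendsto_ofReal (part_tendsto G c (XX a w))
  refine ⟨aemeasurable_of_tendsto_metrizable_ae atTop hm (ae_of_all _ ht), ?_⟩
  calc ∫⁻ w, ENNReal.ofReal (elemCapital G c 1 (XX a w)) ∂gP
      = ∫⁻ w, liminf (fun N => ENNReal.ofReal (part G c N (XX a w))) atTop ∂gP :=
        lintegral_congr fun w => (ht w).liminf_eq.symm
    _ ≤ liminf (fun N => ∫⁻ w, ENNReal.ofReal (part G c N (XX a w)) ∂gP) atTop :=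
        lintegral_liminf_le' hm
    _ = ENNReal.ofReal c := by
        have : ∀ N, ∫⁻ w, ENNReal.ofReal (part G c N (XX a w)) ∂gP = ENNReal.ofReal c := by
          intro N
          rw [← ofReal_integral_eq_lintegral_ofReal (part_int G c a N).1
            (ae_of_all _ fun w => (h0 _ _).trans_eq (part_eq G c N (XX a w)).symm), (part_int G c a N).2]
        simp_rw [this]
        exact liminf_const _

lemma XX_late (a : ℝ) (w : GW) (G : ElemStrategy) (c : ℝ) {t : ℝ≥0} (ht : 1 ≤ t) :
    elemCapital G c t (XX a w) = elemCapital G c 1 (XX a w) := by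
  have key : ∀ k, (XX a w).1 (clip (G.τ k) t (XX a w)) = (XX a w).1 (clip (G.τ k) 1 (XX a w)) := by
    intro k
    change bm w _ = bm w _
    congr 1
    have h1 : min (t : ℝ≥0∞) (sig a w) = sig a w :=
      min_eq_right (by exact_mod_cast (sig_le_one a w).trans ht)
    have h2 : min ((1 : ℝ≥0) : ℝ≥0∞) (sig a w) = sig a w :=
      min_eq_right (by exact_mod_cast (sig_le_one a w))
    rw [← ENNReal.coe_inj, ENNReal.coe_min, ENNReal.coe_min, coe_clip, coe_clip, min_assoc,
      min_assoc, h1, h2]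
  unfold elemCapital
  simp_rw [key]

lemma value_late (S : PosCapital) (a : ℝ) (w : GW) :
    liminf (fun t : ℝ≥0 => S.value t (XX a w)) atTop = S.value 1 (XX a w) := by
  have : (fun t : ℝ≥0 => S.value t (XX a w)) =ᶠ[atTop] fun _ => S.value 1 (XX a w) := by
    filter_upwards [eventually_ge_atTop 1] with t ht
    unfold PosCapital.value
    simp_rw [XX_late a w _ _ ht]
  rw [liminf_congr this, liminf_const]

lemma value_bound (S : PosCapital) (a : ℝ) : ∫⁻ w, S.value 1 (XX a w) ∂gP ≤ S.init := by
  unfold PosCapital.value PosCapital.init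
  rw [lintegral_tsum fun n => (cap_bound (S.G n) (S.c n) a (S.nonneg n)).1]
  exact ENNReal.tsum_le_tsum fun n => (cap_bound (S.G n) (S.c n) a (S.nonneg n)).2

lemma prob_le (S : PosCapital) (E : Set Omega)
    (hE : {ω : Omega | ∃ t : ℝ≥0, 0 < t ∧
        (RayOfLocalExt (· ≤ ·) ω t ∨ RayOfLocalExt (· ≥ ·) ω t)} ⊆ E)
    (hS : ∀ ω : Omega, E.indicator (fun _ => (1 : ℝ≥0∞)) ω
      ≤ liminf (fun t : ℝ≥0 => S.value t ω) atTop) (a : ℝ) (ha : 0 < a) :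
    gP {w | a ≤ |bm w 1|} ≤ S.init := by
  refine le_trans ?_ (value_bound S a)
  have hms : MeasurableSet {w | a ≤ |bm w 1|} :=
    (measurable_norm.comp (measurable_bm 1)) measurableSet_Ici
  rw [← lintegral_indicator_one hms]
  refine lintegral_mono fun w => ?_
  by_cases hw : w ∈ {w | a ≤ |bm w 1|}
  · rw [Set.indicator_of_mem hw]
    have := hS (XX a w)
    rw [Set.indicator_of_mem (hE (XX_mem a ha w hw)), value_late] at this
    exact this
  · rw [Set.indicator_of_notMem hw]
    exact zero_le

lemma one_le_init (S : PosCapital) (E : Set Omega)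
    (hE : {ω : Omega | ∃ t : ℝ≥0, 0 < t ∧
        (RayOfLocalExt (· ≤ ·) ω t ∨ RayOfLocalExt (· ≥ ·) ω t)} ⊆ E)
    (hS : ∀ ω : Omega, E.indicator (fun _ => (1 : ℝ≥0∞)) ω
      ≤ liminf (fun t : ℝ≥0 => S.value t ω) atTop) : 1 ≤ S.init := by
  have hmono : Monotone fun n : ℕ => {w : GW | (1 : ℝ) / (n + 1) ≤ |bm w 1|} := by
    intro i j hij w hw
    have hw' : (1 : ℝ) / (i + 1) ≤ |bm w 1| := hw
    exact (Nat.one_div_le_one_div hij).trans hw'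
  have hun : (⋃ n : ℕ, {w : GW | (1 : ℝ) / (n + 1) ≤ |bm w 1|}) = {w | bm w 1 = 0}ᶜ := by
    ext w
    simp only [Set.mem_iUnion, Set.mem_compl_iff, Set.mem_ofPred_eq]
    constructor
    · rintro ⟨n, hn⟩ h
      rw [h, abs_zero] at hn
      have : (0 : ℝ) < 1 / (n + 1) := by positivity
      linarith
    · intro h
      obtain ⟨n, hn⟩ := exists_nat_one_div_lt (abs_pos.2 h)
      exact ⟨n, hn.le⟩
  have h1 : gP {w | bm w 1 = 0}ᶜ = 1 := by
    have hm : MeasurableSet {w | bm w 1 = 0} := measurable_bm 1 (measurableSet_singleton 0)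
    rw [prob_compl_eq_one_iff hm]
    exact bm_one_ne
  rw [← h1, ← hun, hmono.measure_iUnion]
  exact iSup_le fun n => prob_le S E hE hS _ (by positivity)

/-- The constant path. -/
def zeroPath : Omega := ⟨fun _ => 0, continuous_const⟩

lemma zeroPath_notMem : zeroPath ∈ {ω : Omega | ∃ t : ℝ≥0, 0 < t ∧
        (RayOfLocalExt (· ≤ ·) ω t ∨ RayOfLocalExt (· ≥ ·) ω t)}ᶜ := by
  rintro ⟨t, ht, h | h⟩ <;>
    exact h.2.1 ⟨t / 2, by positivity, NNReal.half_lt_self ht.ne', fun _ _ => rfl⟩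

lemma value_zeroPath (S : PosCapital) (t : ℝ≥0) : S.value t zeroPath = S.init := by
  unfold PosCapital.value PosCapital.init elemCapital zeroPath
  simp

/-- The strategy that never trades. -/
noncomputable def idle : ElemStrategy where
  τ n _ := n
  stopping n t := by
    by_cases h : (n : ℝ≥0∞) ≤ t
    · simp [h]
    · simp [h]
  mono n ω := by exact_mod_cast Nat.le_succ n
  tendsto_top ω := ENNReal.tendsto_nat_nhds_top
  h _ _ := 0
  h_bdd n := ⟨0, fun ω => by simp⟩
  h_meas n B hB t := by
    by_cases h : (n : ℝ≥0∞) ≤ t <;> by_cases h0 : (0 : ℝ) ∈ B <;> simp [h, h0]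

lemma elem_idle (c : ℝ) (t : ℝ≥0) (ω : Omega) : elemCapital idle c t ω = c := by
  simp [elemCapital, idle]

noncomputable def idleCap : PosCapital where
  G _ := idle
  c n := 1 / 2 / 2 ^ n
  c_pos n := by positivity
  c_summable := summable_geometric_two' 1
  nonneg n t ω := by rw [elem_idle]; positivity

lemma idle_init : idleCap.init = 1 := by
  unfold PosCapital.init
  change ∑' n : ℕ, ENNReal.ofReal ((1 : ℝ) / 2 / 2 ^ n) = 1
  rw [← ENNReal.ofReal_tsum_of_nonneg (fun n => by positivity) (summable_geometric_two' 1),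
    tsum_geometric_two' 1, ENNReal.ofReal_one]

lemma idle_value (t : ℝ≥0) (ω : Omega) : idleCap.value t ω = 1 := by
  rw [← idle_init]
  unfold PosCapital.value PosCapital.init
  refine tsum_congr fun n => ?_
  congr 1
  exact elem_idle _ _ _

lemma upProb_le_one (E : Set Omega) : UpProb E ≤ 1 := by
  unfold UpProb
  refine (iInf₂_le idleCap fun ω => ?_).trans idle_init.le
  simp_rw [idle_value, liminf_const]
  exact Set.indicator_le_self' (fun _ _ => zero_le) ω

/-- the event that for some `t ∈ (0,∞)` the ray `[t,∞)` is a ray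
of local maximum or of local minimum for `ω` is completely uncertain. -/
theorem ray_of_local_extremum_completely_uncertain :
    UpProb {ω : Omega | ∃ t : ℝ≥0, 0 < t ∧
        (RayOfLocalExt (· ≤ ·) ω t ∨ RayOfLocalExt (· ≥ ·) ω t)} = 1 ∧
      UpProb {ω : Omega | ∃ t : ℝ≥0, 0 < t ∧
        (RayOfLocalExt (· ≤ ·) ω t ∨ RayOfLocalExt (· ≥ ·) ω t)}ᶜ = 1 := by
  refine ⟨le_antisymm (upProb_le_one _) ?_, le_antisymm (upProb_le_one _) ?_⟩
  · exact le_iInf₂ fun S hS => one_le_init S _ subset_rfl hS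
  · refine le_iInf₂ fun S hS => ?_
    have := hS zeroPath
    rw [Set.indicator_of_mem zeroPath_notMem] at this
    simp_rw [value_zeroPath, liminf_const] at this
    exact this

end GTP
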